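/- Let p be a prime, n ≥ 1, α > 0, N ∈ ℤ, Ω = B_N ⊆ ℚ_p^n. Let u : K^n → ℝ be bounded, measurable and locally constant. Then the integrals defining (D^{α,n}u)(x) for x ∈ Ω and (N_α u)(y) for y ∈ Ω^c are absolutely convergent, x ↦ (D^{α,n}u)(x) is integrable over Ω, y ↦ (N_α u)(y) is integrable over Ω^c, and ∫_Ω (D^{α,n}u)(x) dx = − ∫_{Ω^c} (N_α u)(y) dy. -/

import Mathlib

noncomputable section

open MeasureTheory Metric ENNReal

instance (p : ℕ) [Fact p.Prime] : MeasurableSpace ℚ_[p] := borel _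
instance (p : ℕ) [Fact p.Prime] : BorelSpace ℚ_[p] := ⟨rfl⟩

/-- The closed unit ball `ℤ_p ⊆ ℚ_p` as a positive compact set. -/
def padicUnitBall (p : ℕ) [Fact p.Prime] : TopologicalSpace.PositiveCompacts ℚ_[p] where
  carrier := Metric.closedBall 0 1
  isCompact' := isCompact_closedBall 0 1
  interior_nonempty' := by
    rw [IsOpen.interior_eq (IsUltrametricDist.isOpen_closedBall 0 one_ne_zero)]
    exact ⟨0, Metric.mem_closedBall_self zero_le_one⟩

/-- Additive Haar measure on `ℚ_p`, normalized so that `ℤ_p` has measure `1`. -/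
def padicHaar (p : ℕ) [Fact p.Prime] : Measure ℚ_[p] :=
  Measure.addHaarMeasure (padicUnitBall p)

/-- The product Haar measure on `K^n = ℚ_p^n`, normalized so that `ℤ_p^n` has measure `1`. -/
def padicHaarN (p : ℕ) [Fact p.Prime] (n : ℕ) : Measure (Fin n → ℚ_[p]) :=
  Measure.pi fun _ => padicHaar p

/-- The ball `B_N = {x ∈ K^n : ‖x‖ ≤ p^N}`, where `‖x‖ = max |x_j|_p` is the sup norm. -/
def Bball (p : ℕ) [Fact p.Prime] (n : ℕ) (N : ℤ) : Set (Fin n → ℚ_[p]) :=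
  {x | ‖x‖ ≤ (p : ℝ) ^ N}

/-- The constant `c_{n,α} = (p^α − 1)/(1 − p^{−α−n})`. -/
def cna (p n : ℕ) (α : ℝ) : ℝ := ((p : ℝ) ^ α - 1) / (1 - (p : ℝ) ^ (-α - (n : ℝ)))

/-- The Vladimirov–Taibleson operator `(D^{α,n}u)(x) = c_{n,α} ∫ (u(x)−u(y))/‖x−y‖^{n+α} dy`. -/
def Dop (p : ℕ) [Fact p.Prime] (n : ℕ) (α : ℝ) (u : (Fin n → ℚ_[p]) → ℝ)
    (x : Fin n → ℚ_[p]) : ℝ :=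
  cna p n α * ∫ y, (u x - u y) / ‖x - y‖ ^ ((n : ℝ) + α) ∂padicHaarN p n

/-- The nonlocal normal derivative `(N_α u)(x) = c_{n,α} ∫_Ω (u(x)−u(y))/‖x−y‖^{n+α} dy`. -/
def Nop (p : ℕ) [Fact p.Prime] (n : ℕ) (α : ℝ) (N : ℤ) (u : (Fin n → ℚ_[p]) → ℝ)
    (x : Fin n → ℚ_[p]) : ℝ :=
  cna p n α * ∫ y in Bball p n N, (u x - u y) / ‖x - y‖ ^ ((n : ℝ) + α) ∂padicHaarN p n

instance padicHaar_isAddHaar (p : ℕ) [Fact p.Prime] : (padicHaar p).IsAddHaarMeasure := by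
  unfold padicHaar; infer_instance

instance padicHaarN_isAddHaar (p : ℕ) [Fact p.Prime] (n : ℕ) :
    (padicHaarN p n).IsAddHaarMeasure := by
  unfold padicHaarN; infer_instance

instance padicHaarN_sigmaFinite (p : ℕ) [Fact p.Prime] (n : ℕ) :
    SigmaFinite (padicHaarN p n) := by
  unfold padicHaarN; infer_instance

lemma padicHaar_step (p : ℕ) [Fact p.Prime] (k : ℤ) :
    padicHaar p (closedBall 0 ((p : ℝ) ^ (k + 1))) ≤
      (p : ℝ≥0∞) * padicHaar p (closedBall 0 ((p : ℝ) ^ k)) := by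
  have hp0 : (p : ℝ) ≠ 0 := by exact_mod_cast (Fact.out : p.Prime).ne_zero
  have hp0' : (p : ℚ_[p]) ≠ 0 := by exact_mod_cast (Fact.out : p.Prime).ne_zero
  have hppos : (0 : ℝ) < p := by exact_mod_cast (Fact.out : p.Prime).pos
  have hsub : closedBall (0 : ℚ_[p]) ((p : ℝ) ^ (k + 1)) ⊆
      ⋃ i ∈ Finset.range p,
        closedBall ((i : ℚ_[p]) * (p : ℚ_[p]) ^ (-(k + 1))) ((p : ℝ) ^ k) := by
    intro x hx
    rw [mem_closedBall_zero_iff] at hx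
    have hz : ‖x * (p : ℚ_[p]) ^ (k + 1)‖ ≤ 1 := by
      rw [norm_mul, Padic.norm_p_zpow, zpow_neg]
      have h1 : (0 : ℝ) < (p : ℝ) ^ (k + 1) := by positivity
      rw [← div_eq_mul_inv]
      exact (div_le_one h1).2 hx
    obtain ⟨i, hi, hmem⟩ := PadicInt.exists_mem_range (p := p) ⟨_, hz⟩
    simp only [Set.mem_iUnion, Finset.mem_range]
    refine ⟨i, hi, ?_⟩
    rw [PadicInt.maximalIdeal_eq_span_p, ← pow_one (p : ℤ_[p]),
      ← PadicInt.norm_le_pow_iff_mem_span_pow] at hmem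
    have hm : ‖x * (p : ℚ_[p]) ^ (k + 1) - (i : ℚ_[p])‖ ≤ (p : ℝ) ^ (-1 : ℤ) := by
      have h3 := hmem
      rw [PadicInt.norm_def] at h3
      exact_mod_cast h3
    rw [mem_closedBall, dist_eq_norm]
    have : x - (i : ℚ_[p]) * (p : ℚ_[p]) ^ (-(k + 1)) =
        (x * (p : ℚ_[p]) ^ (k + 1) - (i : ℚ_[p])) * (p : ℚ_[p]) ^ (-(k + 1)) := by
      rw [sub_mul, mul_assoc, ← zpow_add₀ hp0']; simp
    rw [this, norm_mul, Padic.norm_p_zpow, neg_neg]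
    calc _ ≤ (p : ℝ) ^ (-1 : ℤ) * (p : ℝ) ^ (k + 1) := by gcongr
      _ = _ := by rw [← zpow_add₀ hp0]; congr 1; ring
  refine (measure_mono hsub).trans ((measure_biUnion_finset_le _ _).trans ?_)
  have : ∀ i ∈ Finset.range p,
      padicHaar p (closedBall ((i : ℚ_[p]) * (p : ℚ_[p]) ^ (-(k + 1))) ((p : ℝ) ^ k)) =
      padicHaar p (closedBall 0 ((p : ℝ) ^ k)) := by
    intro i _
    exact Measure.addHaar_closedBall_center _ _ _
  rw [Finset.sum_congr rfl this]
  simp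

lemma padicHaar_ball (p : ℕ) [Fact p.Prime] (m : ℤ) (j : ℕ) :
    padicHaar p (closedBall 0 ((p : ℝ) ^ (m + j))) ≤
      (p : ℝ≥0∞) ^ j * padicHaar p (closedBall 0 ((p : ℝ) ^ m)) := by
  induction j with
  | zero => simp
  | succ j ih =>
    have := padicHaar_step p (m + j)
    push_cast
    rw [← add_assoc]
    refine this.trans ?_
    rw [pow_succ', mul_assoc]
    gcongr

lemma Bball_eq (p : ℕ) [Fact p.Prime] (n : ℕ) (k : ℤ) :
    Bball p n k = closedBall 0 ((p : ℝ) ^ k) := by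
  ext x; simp [Bball]

lemma Bball_meas (p : ℕ) [Fact p.Prime] (n : ℕ) (k : ℤ) : MeasurableSet (Bball p n k) := by
  rw [Bball_eq]; exact measurableSet_closedBall

lemma Bball_lt_top (p : ℕ) [Fact p.Prime] (n : ℕ) (k : ℤ) :
    padicHaarN p n (Bball p n k) < ∞ := by
  rw [Bball_eq]; exact (isCompact_closedBall _ _).measure_lt_top

lemma padicHaarN_ball (p : ℕ) [Fact p.Prime] (n : ℕ) (m : ℤ) (j : ℕ) :
    padicHaarN p n (Bball p n (m + j)) ≤
      ((p : ℝ≥0∞) ^ n) ^ j * padicHaarN p n (Bball p n m) := by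
  have hppos : (0 : ℝ) < p := by exact_mod_cast (Fact.out : p.Prime).pos
  have key : ∀ k : ℤ, padicHaarN p n (Bball p n k) =
      (padicHaar p (closedBall 0 ((p : ℝ) ^ k))) ^ n := by
    intro k
    rw [Bball_eq, closedBall_pi _ (by positivity), padicHaarN, Measure.pi_pi]
    simp
  rw [key, key, ← pow_mul, mul_comm n j, pow_mul, ← mul_pow]
  gcongr
  exact padicHaar_ball p m j

/-- The truncated kernel. -/
def ker (p : ℕ) [Fact p.Prime] (n : ℕ) (α : ℝ) (m : ℤ) (z : Fin n → ℚ_[p]) : ℝ :=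
  (Bball p n m)ᶜ.indicator (fun z => (‖z‖ ^ ((n : ℝ) + α))⁻¹) z

lemma ker_meas (p : ℕ) [Fact p.Prime] (n : ℕ) (α : ℝ) (m : ℤ) : Measurable (ker p n α m) := by
  unfold ker
  refine Measurable.indicator ?_ (Bball_meas p n m).compl
  fun_prop

lemma ker_nonneg (p : ℕ) [Fact p.Prime] (n : ℕ) (α : ℝ) (m : ℤ) (z) : 0 ≤ ker p n α m z := by
  unfold ker
  refine Set.indicator_nonneg (fun z _ => by positivity) z

lemma ker_le (p : ℕ) [Fact p.Prime] (n : ℕ) (α : ℝ) (hα : 0 < α) (m : ℤ) (z) :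
    ENNReal.ofReal (ker p n α m z) ≤
     ∑' j : ℕ, (Bball p n (m + (j + 1 : ℕ))).indicator
      (fun _ => ENNReal.ofReal (((p : ℝ) ^ (m + j)) ^ ((n : ℝ) + α))⁻¹) z := by
  have hp1 : (1 : ℝ) < p := by exact_mod_cast (Fact.out : p.Prime).one_lt
  have hppos : (0 : ℝ) < p := by linarith
  by_cases hz : z ∈ Bball p n m
  · simp [ker, hz]
  have hz' : (p : ℝ) ^ m < ‖z‖ := by simpa [Bball] using hz
  have hex : ∃ j : ℕ, z ∈ Bball p n (m + (j + 1 : ℕ)) := by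
    obtain ⟨j, hj⟩ := pow_unbounded_of_one_lt (‖z‖ / (p : ℝ) ^ m) hp1
    refine ⟨j, ?_⟩
    have h1 : (0 : ℝ) < (p : ℝ) ^ m := by positivity
    rw [div_lt_iff₀ h1] at hj
    change ‖z‖ ≤ _
    refine hj.le.trans ?_
    rw [zpow_add₀ hppos.ne', zpow_natCast, mul_comm]
    gcongr
    · exact hp1.le
    · omega
  classical
  have hlow : (p : ℝ) ^ (m + (Nat.find hex : ℕ) : ℤ) ≤ ‖z‖ := by
    rcases Nat.eq_zero_or_pos (Nat.find hex) with h0 | h0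
    · rw [h0]; simpa using hz'.le
    · have := Nat.find_min hex (m := Nat.find hex - 1) (by omega)
      rw [Nat.sub_add_cancel h0] at this
      have h2 : (p : ℝ) ^ (m + (Nat.find hex : ℕ) : ℤ) < ‖z‖ := by
        simpa [Bball] using this
      exact h2.le
  refine le_trans ?_ (ENNReal.le_tsum (Nat.find hex))
  rw [Set.indicator_of_mem (Nat.find_spec hex)]
  unfold ker
  rw [Set.indicator_of_mem (show z ∈ (Bball p n m)ᶜ from hz)]
  apply ENNReal.ofReal_le_ofReal
  gcongr

lemma ker_integrable (p : ℕ) [Fact p.Prime] (n : ℕ) (α : ℝ) (hα : 0 < α) (m : ℤ) :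
    Integrable (ker p n α m) (padicHaarN p n) := by
  have hp1 : (1 : ℝ) < p := by exact_mod_cast (Fact.out : p.Prime).one_lt
  have hppos : (0 : ℝ) < p := by linarith
  refine ⟨(ker_meas p n α m).aestronglyMeasurable, ?_⟩
  rw [hasFiniteIntegral_iff_ofReal (ae_of_all _ (ker_nonneg p n α m))]
  refine (lintegral_mono (ker_le p n α hα m)).trans_lt ?_
  rw [lintegral_tsum (fun j => (measurable_const.indicator (Bball_meas _ _ _)).aemeasurable)]
  simp_rw [lintegral_indicator_const (Bball_meas _ _ _)]
  set A := ENNReal.ofReal (((p : ℝ) ^ m) ^ ((n : ℝ) + α))⁻¹ with hA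
  set V := padicHaarN p n (Bball p n m) with hV
  have hVt : V < ∞ := Bball_lt_top p n m
  set r := ENNReal.ofReal ((p : ℝ) ^ (-α)) with hr
  have hr1 : r < 1 := by
    rw [hr, ENNReal.ofReal_lt_one]
    exact Real.rpow_lt_one_of_one_lt_of_neg hp1 (by linarith)
  have hterm : ∀ j : ℕ, ENNReal.ofReal (((p : ℝ) ^ (m + j)) ^ ((n : ℝ) + α))⁻¹ *
      padicHaarN p n (Bball p n (m + (j + 1 : ℕ))) ≤ (A * (p : ℝ≥0∞) ^ n * V) * r ^ j := by
    intro j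
    refine (mul_le_mul_right (padicHaarN_ball p n m (j + 1)) _).trans (le_of_eq ?_)
    have e1 : (p : ℝ≥0∞) = ENNReal.ofReal (p : ℝ) := by simp
    have e2 : (((p : ℝ) ^ (m + j)) ^ ((n : ℝ) + α))⁻¹ * ((p : ℝ) ^ n) ^ j =
        (((p : ℝ) ^ m) ^ ((n : ℝ) + α))⁻¹ * ((p : ℝ) ^ (-α)) ^ j := by
      rw [zpow_add₀ hppos.ne', Real.mul_rpow (by positivity) (by positivity), mul_inv, mul_assoc]
      congr 1
      rw [zpow_natCast, ← Real.rpow_natCast, ← Real.rpow_natCast, ← Real.rpow_natCast,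
        ← Real.rpow_natCast, ← Real.rpow_mul hppos.le, ← Real.rpow_mul hppos.le,
        ← Real.rpow_mul hppos.le, ← Real.rpow_neg hppos.le, ← Real.rpow_add hppos]
      congr 1; ring
    have e3 : ENNReal.ofReal (((p : ℝ) ^ (m + j)) ^ ((n : ℝ) + α))⁻¹ * ((p : ℝ≥0∞) ^ n) ^ j =
        A * r ^ j := by
      rw [hA, hr, e1, ← ENNReal.ofReal_pow hppos.le, ← ENNReal.ofReal_pow (by positivity),
        ← ENNReal.ofReal_pow (by positivity), ← ENNReal.ofReal_mul (by positivity),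
        ← ENNReal.ofReal_mul (by positivity), e2]
    rw [pow_succ]
    calc _ = (ENNReal.ofReal (((p : ℝ) ^ (m + j)) ^ ((n : ℝ) + α))⁻¹ * ((p : ℝ≥0∞) ^ n) ^ j)
            * (p : ℝ≥0∞) ^ n * V := by ring
      _ = _ := by rw [e3]; ring
  refine (ENNReal.tsum_le_tsum hterm).trans_lt ?_
  rw [ENNReal.tsum_mul_left, ENNReal.tsum_geometric]
  refine ENNReal.mul_lt_top (ENNReal.mul_lt_top (ENNReal.mul_lt_top ofReal_lt_top ?_) hVt) ?_
  · exact ENNReal.pow_lt_top (ENNReal.natCast_lt_top p)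
  · rw [ENNReal.inv_lt_top]; exact tsub_pos_of_lt hr1

/-- For a bounded, measurable, locally constant `u : K^n → ℝ`, all the
integrals defining `D^{α,n}u` on `Ω` and `N_α u` on `Ω^c` converge absolutely, both
functions are integrable on their domains, and
`∫_Ω D^{α,n}u dx = − ∫_{Ω^c} N_α u dy`. -/
theorem padic_divergence_theorem (p : ℕ) [Fact p.Prime] (n : ℕ) (hn : 1 ≤ n)
    (α : ℝ) (hα : 0 < α) (N : ℤ)
    (u : (Fin n → ℚ_[p]) → ℝ) (humeas : Measurable u)
    (hubdd : ∃ C : ℝ, ∀ x, |u x| ≤ C)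
    (huloc : ∃ ℓ : ℤ, ∀ x x' : Fin n → ℚ_[p], ‖x'‖ ≤ (p : ℝ) ^ (-ℓ) → u (x + x') = u x) :
    (∀ x ∈ Bball p n N,
      Integrable (fun y => (u x - u y) / ‖x - y‖ ^ ((n : ℝ) + α)) (padicHaarN p n)) ∧
    (∀ x ∈ (Bball p n N)ᶜ,
      IntegrableOn (fun y => (u x - u y) / ‖x - y‖ ^ ((n : ℝ) + α))
        (Bball p n N) (padicHaarN p n)) ∧
    IntegrableOn (Dop p n α u) (Bball p n N) (padicHaarN p n) ∧
    IntegrableOn (Nop p n α N u) (Bball p n N)ᶜ (padicHaarN p n) ∧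
    (∫ x in Bball p n N, Dop p n α u x ∂padicHaarN p n)
      = - ∫ y in (Bball p n N)ᶜ, Nop p n α N u y ∂padicHaarN p n := by
  obtain ⟨C, hC⟩ := hubdd
  obtain ⟨l, hl⟩ := huloc
  set μ := padicHaarN p n with hμ
  set Ω := Bball p n N with hΩ
  have hΩm : MeasurableSet Ω := Bball_meas p n N
  have : IsFiniteMeasure (μ.restrict Ω) := ⟨by
    rw [Measure.restrict_apply_univ]; exact Bball_lt_top p n N⟩
  set F : (Fin n → ℚ_[p]) → (Fin n → ℚ_[p]) → ℝ :=
    fun x y => (u x - u y) / ‖x - y‖ ^ ((n : ℝ) + α) with hF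
  have hFm : Measurable (Function.uncurry F) := by
    simp only [hF, Function.uncurry_def]
    fun_prop
  have hC0 : 0 ≤ C := (abs_nonneg _).trans (hC 0)
  set k := ker p n α (-l) with hk
  have hbound : ∀ x y, ‖F x y‖ ≤ 2 * C * k (y - x) := by
    intro x y
    by_cases h : y - x ∈ Bball p n (-l)
    · have : u y = u x := by
        have := hl x (y - x) h
        simpa using this
      simp only [hF, this, sub_self, zero_div, norm_zero]
      exact mul_nonneg (by positivity) (ker_nonneg _ _ _ _ _)
    · rw [hk, ker, Set.indicator_of_mem (show y - x ∈ (Bball p n (-l))ᶜ from h)]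
      simp only [hF]
      rw [norm_div, norm_sub_rev y x, div_eq_mul_inv, Real.norm_eq_abs, Real.norm_eq_abs,
        abs_of_nonneg (show 0 ≤ ‖x - y‖ ^ ((n : ℝ) + α) by positivity)]
      gcongr
      have h1 := abs_le.1 (hC x)
      have h2 := abs_le.1 (hC y)
      rw [abs_le]; constructor <;> linarith
  have hki : ∀ x, Integrable (fun y => 2 * C * k (y - x)) μ := fun x =>
    ((ker_integrable p n α hα (-l)).comp_sub_right x).const_mul _
  have hFx : ∀ x, Integrable (F x) μ := fun x =>
    (hki x).mono' (hFm.comp measurable_prodMk_left).aestronglyMeasurable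
      (ae_of_all _ (hbound x))
  have hprod : Integrable (Function.uncurry F) ((μ.restrict Ω).prod μ) := by
    rw [integrable_prod_iff hFm.aestronglyMeasurable]
    refine ⟨ae_of_all _ hFx, ?_⟩
    refine Integrable.mono' (integrable_const (∫ y, 2 * C * k y ∂μ))
      hFm.norm.stronglyMeasurable.integral_prod_right.aestronglyMeasurable (ae_of_all _ ?_)
    intro x
    rw [Real.norm_of_nonneg (integral_nonneg fun _ => norm_nonneg _)]
    refine (integral_mono (hFx x).norm (hki x) (hbound x)).trans (le_of_eq ?_)
    exact integral_sub_right_eq_self (fun y => 2 * C * k y) x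
  have hpin : Integrable (Function.uncurry F) ((μ.restrict Ω).prod (μ.restrict Ω)) :=
    hprod.mono_measure (Measure.prod_mono le_rfl Measure.restrict_le_self)
  have hpout : Integrable (Function.uncurry F) ((μ.restrict Ω).prod (μ.restrict Ωᶜ)) :=
    hprod.mono_measure (Measure.prod_mono le_rfl Measure.restrict_le_self)
  have hanti : ∀ x y, F y x = - F x y := by
    intro x y
    simp only [hF]
    rw [norm_sub_rev y x, ← neg_div, neg_sub]
  have hD : Dop p n α u = fun x => cna p n α * ∫ y, F x y ∂μ := rfl
  have hN : Nop p n α N u = fun y => -(cna p n α * ∫ x in Ω, F x y ∂μ) := by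
    funext y
    change cna p n α * ∫ x in Ω, F y x ∂μ = _
    simp_rw [hanti _ y, integral_neg, mul_neg]
  refine ⟨fun x _ => hFx x, fun x _ => (hFx x).integrableOn, ?_, ?_, ?_⟩
  · rw [hD]
    exact hprod.integral_prod_left.const_mul _
  · rw [hN]
    exact (hpout.integral_prod_right.const_mul _).neg
  · rw [hD, hN]
    simp only [integral_neg, neg_neg, integral_const_mul]
    congr 1
    have hzero : ∫ x in Ω, ∫ y in Ω, F x y ∂μ ∂μ = 0 := by
      have h1 := integral_integral_swap hpin
      have h2 : ∫ y in Ω, ∫ x in Ω, F x y ∂μ ∂μ = - ∫ x in Ω, ∫ y in Ω, F x y ∂μ ∂μ := by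
        simp_rw [← integral_neg, ← hanti]
      linarith
    have hsplit : ∀ x, ∫ y, F x y ∂μ = ∫ y in Ω, F x y ∂μ + ∫ y in Ωᶜ, F x y ∂μ := fun x =>
      (integral_add_compl hΩm (hFx x)).symm
    simp_rw [hsplit]
    have hadd := integral_add hpin.integral_prod_left hpout.integral_prod_left
    simp only [Function.uncurry_apply_pair] at hadd
    rw [hadd, hzero, zero_add]
    exact integral_integral_swap hpout
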